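/- arXiv:1705.02677 — 4 statements merged into one kernel-verified Lean document; each statement's English description precedes it below -/
import Mathlib

section
/- Let π be a prime, let a be an element of ℤ/πℤ, and let (D_n)_{n≥0} be the sequence in ℤ/πℤ with D_0 = 0, D_1 = 1 and D_n = a·D_{n-1} + D_{n-2} for n ≥ 2. Let l ≥ 2 be an integer with D_l = 0 and D_{l+1} = 1, and set δ'(x) = Σ_{i=1}^{l-1} D_i x^{i-1} in (ℤ/πℤ)[x]. Then δ'(x)·(x² + a x − 1) = x^l − 1; in particular δ'(x) divides x^l − 1 in (ℤ/πℤ)[x]. -/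
open Polynomial

/-- Partial sums of the generating polynomial of a Lucas-type sequence, multiplied by the
reciprocal characteristic polynomial, telescope. -/
theorem sum_range_mul_of_recurrence {R : Type*} [CommRing R] (a : R) (D : ℕ → R)
    (hD0 : D 0 = 0) (hD1 : D 1 = 1) (hD : ∀ n, D (n + 2) = a * D (n + 1) + D n) (m : ℕ) :
    (∑ i ∈ Finset.range m, C (D (i + 1)) * X ^ i) * (X ^ 2 + C a * X - 1) =
      C (D (m + 1)) * X ^ m + C (D m) * X ^ (m + 1) - 1 := by
  induction m with
  | zero => simp [hD0, hD1]
  | succ k ih =>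
    rw [Finset.sum_range_succ, add_mul, ih, hD k, C_add, C_mul]
    ring

/-- For the recurrence `D_n = a D_{n-1} + D_{n-2}` over `ℤ/πℤ` with `D_0 = 0`, `D_1 = 1`,
if `D_l = 0` and `D_{l+1} = 1`, then `δ'(x) = ∑_{i=1}^{l-1} D_i x^{i-1}` satisfies
`δ'(x)(x² + ax − 1) = x^l − 1`; in particular `δ'(x) ∣ x^l − 1`. -/
theorem stmt2 (π : ℕ) (hπ : Nat.Prime π) (a : ZMod π) (D : ℕ → ZMod π)
    (hD0 : D 0 = 0) (hD1 : D 1 = 1)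
    (hD : ∀ n, 2 ≤ n → D n = a * D (n - 1) + D (n - 2))
    (l : ℕ) (hl : 2 ≤ l) (hDl : D l = 0) (hDl1 : D (l + 1) = 1)
    (δ' : Polynomial (ZMod π)) (hδ' : δ' = ∑ i ∈ Finset.Ico 1 l, C (D i) * X ^ (i - 1)) :
    δ' * (X ^ 2 + C a * X - 1) = X ^ l - 1 ∧ δ' ∣ (X ^ l - 1 : Polynomial (ZMod π)) := by
  have hrec : ∀ n, D (n + 2) = a * D (n + 1) + D n := fun n => hD (n + 2) (by omega)
  obtain ⟨k, rfl⟩ : ∃ k, l = k + 1 := ⟨l - 1, by omega⟩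
  have hDk : D k = 1 := by
    have h := hrec k
    rw [hDl1, hDl, mul_zero, zero_add] at h
    exact h.symm
  have hsum : δ' = ∑ i ∈ Finset.range k, C (D (i + 1)) * X ^ i := by
    rw [hδ', Finset.sum_Ico_eq_sum_range]
    simp [add_comm]
  have key : δ' * (X ^ 2 + C a * X - 1) = X ^ (k + 1) - 1 := by
    rw [hsum, sum_range_mul_of_recurrence a D hD0 hD1 hrec k, hDl, hDk]
    simp
  exact ⟨key, Dvd.intro _ key⟩
end

section
/- Let π be a prime, let a be an element of ℤ/πℤ, and let (D_n)_{n≥0} be the sequence in ℤ/πℤ with D_0 = 0, D_1 = 1 and D_n = a·D_{n-1} + D_{n-2} for n ≥ 2. Let l ≥ 3 be the period of this sequence modulo π (so D_{n+l} = D_n for all n, and l is minimal with this property), and let β = #{ i : 0 ≤ i ≤ l−1, D_i = 0 } be the number of zeros in one period. Let v ∈ (ℤ/πℤ)^l be the vector v = (D_1, D_2, …, D_{l-1}, 0) of coefficients of δ'(x) = Σ_{i=1}^{l-1} D_i x^{i-1}, and let C ⊆ (ℤ/πℤ)^l be the ℤ/πℤ-linear span of all l cyclic shifts of v. Then the minimum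 Hamming weight of a nonzero element of C equals l − β. -/
/-- A solution of `f (n + 2) = a * f (n + 1) + f n` expressed through two consecutive values
and the fundamental solution `D`. -/
lemma recurrence_add {R : Type*} [CommRing R] {a : R} {D f : ℕ → R}
    (hD0 : D 0 = 0) (hD1 : D 1 = 1) (hD : ∀ n, D (n + 2) = a * D (n + 1) + D n)
    (hf : ∀ n, f (n + 2) = a * f (n + 1) + f n) (n m : ℕ) :
    f (n + m + 1) = D m * f n + D (m + 1) * f (n + 1) := by
  induction m using Nat.twoStepInduction with
  | zero => simp [hD0, hD1]
  | one =>
    have h2 : D 2 = a := by simpa [hD0, hD1] using hD 0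
    simp only [hD1, h2, Nat.reduceAdd]
    rw [show n + 1 + 1 = n + 2 from rfl, hf]
    ring
  | more m ih₁ ih₂ =>
    have h := hf (n + m + 1)
    rw [show n + (m + 2) + 1 = n + m + 1 + 2 by ring, h,
      show n + m + 1 + 1 = n + (m + 1) + 1 by ring, ih₂, ih₁,
      show m + 2 + 1 = m + 1 + 2 by ring, hD (m + 1), hD m]
    ring

lemma hammingNorm_add_count {R : Type*} [Zero R] [DecidableEq R] {l : ℕ} {c : Fin l → R}
    {f : ℕ → R} (hc : ∀ i : Fin l, c i = f i) :
    hammingNorm c + l.count (fun n => f n = 0) = l := by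
  have hcount : l.count (fun n => f n = 0) = (Finset.univ.filter fun i => c i = 0).card := by
    simp only [Nat.count_eq_card_filter_range, Finset.card_filter, Finset.sum_range, hc]
  rw [hcount, hammingNorm, add_comm]
  simpa using Finset.card_filter_add_card_filter_not (s := Finset.univ) (fun i => c i = 0)

lemma count_add_of_periodic {R : Type*} [Zero R] [DecidableEq R] {l : ℕ} {f : ℕ → R}
    (hf : ∀ n, f (n + l) = f n) (j : ℕ) :
    l.count (fun n => f (j + n) = 0) = l.count (fun n => f n = 0) := by
  have hp : Function.Periodic (fun n => f n = 0) l := fun n => by simp [hf]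
  have h₁ := Nat.count_add (fun n => f n = 0) j l
  have h₂ := Nat.count_add (fun n => f n = 0) l j
  have h₃ : j.count (fun n => f (l + n) = 0) = j.count (fun n => f n = 0) := by
    simp only [add_comm l, hf]
  rw [add_comm l j] at h₂
  lia

/-- A nonzero periodic solution of the recurrence has at most as many zeros in a period as the
fundamental solution `D`. -/
lemma count_zeros_le {R : Type*} [CommRing R] [IsDomain R] [DecidableEq R] {a : R} {l : ℕ}
    {D f : ℕ → R} (hD0 : D 0 = 0) (hD1 : D 1 = 1)
    (hD : ∀ n, D (n + 2) = a * D (n + 1) + D n)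
    (hf : ∀ n, f (n + 2) = a * f (n + 1) + f n)
    (hper : ∀ n, f (n + l) = f n) (hne : ∃ i < l, f i ≠ 0) :
    l.count (fun n => f n = 0) ≤ l.count (fun n => D n = 0) := by
  by_cases hz : ∃ j, f j = 0
  · obtain ⟨j, hj⟩ := hz
    have hshift (m : ℕ) : f (j + m) = D m * f (j + 1) := by
      cases m with
      | zero => simp [hD0, hj]
      | succ m => simpa [hj, add_assoc] using recurrence_add hD0 hD1 hD hf j m
    generalize f (j + 1) = u at hshift
    have hu : u ≠ 0 := by
      intro h0
      obtain ⟨i, hi, hfi⟩ := hne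
      have hcount := count_add_of_periodic hper j
      simp only [hshift, h0, mul_zero, Nat.count_true] at hcount
      exact hfi (Nat.count_iff_forall.mp hcount.symm i hi)
    rw [← count_add_of_periodic hper j]
    simp [hshift, hu]
  · push Not at hz
    simp [hz]


/-- **Theorem 2.4 (minimum distance).** Let `D` be the sequence over `ℤ/πℤ` with
`D_0 = 0`, `D_1 = 1`, `D_n = a D_{n-1} + D_{n-2}`, let `l ≥ 3` be its (minimal) period
and `β` the number of zeros in one period. Let `v = (D_1, …, D_{l-1}, 0)` be the
coefficient vector of `δ'(x)` and `C` the span of all cyclic shifts of `v`. Then the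
minimum Hamming weight of a nonzero codeword of `C` is `l − β`. -/
theorem stmt4 (π : ℕ) [Fact (Nat.Prime π)] (a : ZMod π) (D : ℕ → ZMod π)
    (hD0 : D 0 = 0) (hD1 : D 1 = 1)
    (hD : ∀ n, 2 ≤ n → D n = a * D (n - 1) + D (n - 2))
    (l : ℕ) (hl : 3 ≤ l)
    (hper : ∀ n, D (n + l) = D n)
    (hmin : ∀ l', 0 < l' → l' < l → ¬ (∀ n, D (n + l') = D n))
    (β : ℕ) (hβ : β = (Finset.range l |>.filter fun i => D i = 0).card)
    (v : Fin l → ZMod π)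
    (hv : ∀ i : Fin l, v i = if (i : ℕ) < l - 1 then D ((i : ℕ) + 1) else 0)
    (Code : Submodule (ZMod π) (Fin l → ZMod π))
    (hCode : Code = Submodule.span (ZMod π)
      (Set.range fun k : Fin l => fun i : Fin l => v (i - k))) :
    IsLeast {w : ℕ | ∃ c ∈ Code, c ≠ 0 ∧ hammingNorm c = w} (l - β) := by
  obtain rfl | hl' := Nat.eq_zero_or_pos l
  · omega
  have : NeZero l := ⟨hl'.ne'⟩
  have hrec (n : ℕ) : D (n + 2) = a * D (n + 1) + D n := hD (n + 2) (by omega)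
  have hvD (i : Fin l) : v i = D (i + 1) := by
    rw [hv]
    split_ifs with h
    · rfl
    · have hi : (i : ℕ) + 1 = 0 + l := by omega
      rw [hi, hper, hD0]
  have hmod (n : ℕ) : D (n % l) = D n := Function.Periodic.map_mod_nat hper n
  have hshift (k i : Fin l) : v (i - k) = D (i + (l - k) + 1) := by
    rw [hvD, ← hmod, Fin.sub_def, ← hmod (i + (l - k) + 1)]
    simp [Nat.add_comm]
  have hβ' : β = l.count (fun n => D n = 0) := by rw [hβ, Nat.count_eq_card_filter_range]
  constructor
  · have hcount : l.count (fun n => D (n + 1) = 0) = β := by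
      simpa [hβ', add_comm 1] using count_add_of_periodic hper 1
    have hnorm := hammingNorm_add_count (f := fun n => D (n + 1)) hvD
    refine ⟨v, ?_, ?_, by omega⟩
    · rw [hCode]
      exact Submodule.subset_span ⟨0, by simp⟩
    · intro h
      simpa [hvD, hD1] using congrFun h 0
  · rintro w ⟨c, hc, hc0, rfl⟩
    let W : Submodule (ZMod π) (Fin l → ZMod π) :=
      Submodule.span (ZMod π) {fun i : Fin l => D i, fun i : Fin l => D (i + 1)}
    have hW : Code ≤ W := by
      rw [hCode, Submodule.span_le]
      rintro _ ⟨k, rfl⟩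
      refine Submodule.mem_span_pair.mpr ⟨D (l - k), D (l - k + 1), funext fun i => ?_⟩
      simp [hshift, recurrence_add hD0 hD1 hrec hrec]
    obtain ⟨x, y, rfl⟩ := Submodule.mem_span_pair.mp (hW hc)
    have hxy (i : Fin l) : (x • (fun i : Fin l => D i) + y • fun i : Fin l => D (i + 1)) i =
        x * D i + y * D (i + 1) := rfl
    have hnorm := hammingNorm_add_count (f := fun n => x * D n + y * D (n + 1)) hxy
    have hle : l.count (fun n => x * D n + y * D (n + 1) = 0) ≤ l.count (fun n => D n = 0) := by
      refine count_zeros_le (f := fun n => x * D n + y * D (n + 1)) hD0 hD1 hrec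
        (fun n => ?_) (fun n => ?_) ?_
      · simp only [hrec]
        ring
      · simp only [add_right_comm n l 1, hper]
      · obtain ⟨i, hi⟩ := Function.ne_iff.mp hc0
        exact ⟨i, i.isLt, hi⟩
    omega
end

section
/- Let (D_n)_{n≥0} be the integer sequence with D_0 = 0, D_1 = D_2 = 1 and D_{n+3} = D_{n+2} + 3·D_{n+1} + D_n for all n ≥ 0, and let (P_n)_{n≥0} be the Pell sequence (P_0 = 0, P_1 = 1, P_n = 2·P_{n-1} + P_{n-2}). Then D_{n+1} + D_n = P_{n+1} for all n ≥ 0. -/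
/-- If `D_0 = 0`, `D_1 = D_2 = 1`, `D_{n+3} = D_{n+2} + 3 D_{n+1} + D_n`, and `P` is the
Pell sequence, then `D_{n+1} + D_n = P_{n+1}` for all `n ≥ 0`. -/
theorem stmt6 (D P : ℕ → ℤ)
    (hD0 : D 0 = 0) (hD1 : D 1 = 1) (hD2 : D 2 = 1)
    (hD : ∀ n, D (n + 3) = D (n + 2) + 3 * D (n + 1) + D n)
    (hP0 : P 0 = 0) (hP1 : P 1 = 1)
    (hP : ∀ n, P (n + 2) = 2 * P (n + 1) + P n) :
    ∀ n, D (n + 1) + D n = P (n + 1) := by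
  intro n
  induction n using Nat.twoStepInduction with
  | zero => rw [hD0, hD1, hP1, add_zero]
  | one => linarith [hP 0]
  | more n ih₀ ih₁ => linarith [hD n, hP (n + 1)]
end

section
/- Let α, β be nonzero rational numbers, let n ≥ 1 be an integer and p, q be integers. Let r_k = p·P_{k-1} + q·Q_k (for k ≥ 1) be the generalized Pell-Fibonacci-Lucas numbers, and let R_n^{p,q} = r_n·1 + r_{n+1}·i + r_{n+2}·j + r_{n+3}·k be the corresponding quaternion in the generalized quaternion algebra H_ℚ(α, β). Then R_n^{p,q} = 0 if and only if p = 0 and q = 0. -/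
open Quaternion

/-- A sequence with `r (k + 2) = 2 * r (k + 1) + r k` from index `1` on that vanishes at two
consecutive positive indices vanishes at the indices `1` and `2`. -/
theorem initial_terms_eq_zero_of_pell_recurrence {r : ℕ → ℤ}
    (hr : ∀ k, 1 ≤ k → r (k + 2) = 2 * r (k + 1) + r k) {n : ℕ} (hn : 1 ≤ n)
    (h₀ : r n = 0) (h₁ : r (n + 1) = 0) : r 1 = 0 ∧ r 2 = 0 := by
  induction n, hn using Nat.le_induction with
  | base => exact ⟨h₀, h₁⟩
  | succ m hm ih =>
    have h := hr m hm
    rw [show m + 2 = m + 1 + 1 from rfl, h₁, h₀] at h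
    exact ih (by linarith) h₀

/-- **Remark 3.4.** Let `r_k = p P_{k-1} + q Q_k` be the generalized
Pell-Fibonacci-Lucas numbers and `R_n = r_n + r_{n+1} i + r_{n+2} j + r_{n+3} k` the
corresponding quaternion in `ℍ_ℚ(α, β)` (`α, β ≠ 0`). Then `R_n = 0 ↔ p = q = 0`. -/
theorem stmt12 (α β : ℚ) (hα : α ≠ 0) (hβ : β ≠ 0)
    (P Q : ℕ → ℤ)
    (hP0 : P 0 = 0) (hP1 : P 1 = 1) (hP : ∀ n, P (n + 2) = 2 * P (n + 1) + P n)
    (hQ0 : Q 0 = 2) (hQ1 : Q 1 = 2) (hQ : ∀ n, Q (n + 2) = 2 * Q (n + 1) + Q n)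
    (n : ℕ) (hn : 1 ≤ n) (p q : ℤ)
    (r : ℕ → ℤ) (hr : ∀ k, 1 ≤ k → r k = p * P (k - 1) + q * Q k)
    (R : ℍ[ℚ, α, β])
    (hR : R = ⟨(r n : ℚ), (r (n + 1) : ℚ), (r (n + 2) : ℚ), (r (n + 3) : ℚ)⟩) :
    R = 0 ↔ p = 0 ∧ q = 0 := by
  subst hR
  constructor
  · intro h
    have h₀ : r n = 0 := by simpa using congrArg QuaternionAlgebra.re h
    have h₁ : r (n + 1) = 0 := by simpa using congrArg QuaternionAlgebra.imI h
    have hrec : ∀ k, 1 ≤ k → r (k + 2) = 2 * r (k + 1) + r k := by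
      intro k hk
      obtain ⟨m, rfl⟩ := Nat.exists_eq_add_of_le' hk
      have e₀ := hr (m + 1) (by omega)
      have e₁ := hr (m + 1 + 1) (by omega)
      have e₂ := hr (m + 1 + 2) (by omega)
      rw [show m + 1 - 1 = m by omega] at e₀
      rw [show m + 1 + 1 - 1 = m + 1 by omega] at e₁
      rw [show m + 1 + 2 - 1 = m + 2 by omega, hP, hQ] at e₂
      rw [e₀, e₁, e₂]
      ring
    obtain ⟨h1, h2⟩ := initial_terms_eq_zero_of_pell_recurrence hrec hn h₀ h₁
    rw [hr 1 le_rfl, Nat.sub_self, hP0, hQ1] at h1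
    rw [hr 2 one_le_two, show 2 - 1 = 1 from rfl, hP1, hQ 0, hQ0, hQ1] at h2
    constructor <;> linarith
  · rintro ⟨rfl, rfl⟩
    have hr0 : ∀ k, 1 ≤ k → r k = 0 := fun k hk => by simp [hr k hk]
    ext <;> simp [hr0 n hn, hr0]
end
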